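/- Let Z ∈ ℝ^{n×r}, let ν > 0, let ψ be admissible for ν, and set M′ := #{ j : ‖Z(:,j)‖₂ ≥ ν }. Then ‖Z‖_{F,1}^ψ ≥ (1/ν)·dist(Z, Q^{M′}) + M′. (Key inequality of Case 2 in the proof of Theorem 3.2, matrix case.) -/

import Mathlib

open scoped Matrix

/-- Euclidean norm of the `j`-th column of a real matrix. -/
noncomputable def colNorm {n r : ℕ} (Z : Matrix (Fin n) (Fin r) ℝ) (j : Fin r) : ℝ :=
  Real.sqrt (∑ i, (Z i j) ^ 2)

/-- Column sparsity `‖Z‖_{F,0}`: the number of nonzero columns of `Z`. -/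
noncomputable def colSparsity {n r : ℕ} (Z : Matrix (Fin n) (Fin r) ℝ) : ℕ :=
  {j : Fin r | (fun i => Z i j) ≠ 0}.ncard

/-- Frobenius norm of a real matrix. -/
noncomputable def frobNorm {n r : ℕ} (X : Matrix (Fin n) (Fin r) ℝ) : ℝ :=
  Real.sqrt (∑ i, ∑ j, (X i j) ^ 2)

/-- `Ω`: matrices `Z` admitting an orthonormal factor `D` with `DᵀD = I` and `L = D Zᵀ`. -/
def Omega {n1 n2 : ℕ} (r : ℕ) (L : Matrix (Fin n1) (Fin n2) ℝ) :
    Set (Matrix (Fin n2) (Fin r) ℝ) :=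
  {Z | ∃ D : Matrix (Fin n1) (Fin r) ℝ, Dᵀ * D = 1 ∧ L = D * Zᵀ}

/-- `Q^s`: matrices with at most `s` nonzero columns. -/
def Qset (n r : ℕ) (s : ℕ) : Set (Matrix (Fin n) (Fin r) ℝ) :=
  {Z | colSparsity Z ≤ s}

/-- Frobenius distance from `Z` to the set `Q^s`. -/
noncomputable def distQ {n r : ℕ} (Z : Matrix (Fin n) (Fin r) ℝ) (s : ℕ) : ℝ :=
  sInf {d : ℝ | ∃ Z' ∈ Qset n r s, d = frobNorm (Z - Z')}

/-- `ψ` is admissible for `ν`: `ψ(0)=0`, `x/ν ≤ ψ(x) < 1` on `(0,ν)`, `ψ(x)=1` on `[ν,∞)`. -/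
def Admissible (ν : ℝ) (ψ : ℝ → ℝ) : Prop :=
  ψ 0 = 0 ∧ (∀ x : ℝ, 0 < x → x < ν → x / ν ≤ ψ x ∧ ψ x < 1) ∧ ∀ x : ℝ, ν ≤ x → ψ x = 1

/-- `‖Z‖_{F,1}^ψ = Σ_j ψ(‖Z(:,j)‖₂)`. -/
noncomputable def psiNorm {n r : ℕ} (ψ : ℝ → ℝ) (Z : Matrix (Fin n) (Fin r) ℝ) : ℝ :=
  ∑ j, ψ (colNorm Z j)

theorem colNorm_nonneg {n r : ℕ} (Z : Matrix (Fin n) (Fin r) ℝ) (j : Fin r) : 0 ≤ colNorm Z j :=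
  Real.sqrt_nonneg _

theorem frobNorm_le_sum_colNorm {n r : ℕ} (X : Matrix (Fin n) (Fin r) ℝ) :
    frobNorm X ≤ ∑ j, colNorm X j := by
  refine Real.sqrt_le_iff.mpr ⟨Finset.sum_nonneg fun j _ => colNorm_nonneg X j, ?_⟩
  have h : ∑ i, ∑ j, (X i j) ^ 2 = ∑ j, colNorm X j ^ 2 := by
    rw [Finset.sum_comm]
    exact Finset.sum_congr rfl fun j _ =>
      (Real.sq_sqrt (Finset.sum_nonneg fun i _ => sq_nonneg _)).symm
  rw [h]
  exact Finset.sum_sq_le_sq_sum_of_nonneg fun j _ => colNorm_nonneg X j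

theorem distQ_le_frobNorm_sub {n r s : ℕ} (Z : Matrix (Fin n) (Fin r) ℝ)
    {Z' : Matrix (Fin n) (Fin r) ℝ} (hZ' : Z' ∈ Qset n r s) :
    distQ Z s ≤ frobNorm (Z - Z') := by
  refine csInf_le ⟨0, ?_⟩ ⟨Z', hZ', rfl⟩
  rintro d ⟨W, -, rfl⟩
  exact Real.sqrt_nonneg _

open Classical in
/-- Zeroing the columns of `Z` outside `S` gives an upper bound on `dist(Z, Q^{#S})`. -/
theorem distQ_ncard_le_sum_colNorm {n r : ℕ} (Z : Matrix (Fin n) (Fin r) ℝ) (S : Set (Fin r)) :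
    distQ Z S.ncard ≤ ∑ j, if j ∈ S then 0 else colNorm Z j := by
  let Z' : Matrix (Fin n) (Fin r) ℝ := Matrix.of fun i j => if j ∈ S then Z i j else 0
  have hZ' : Z' ∈ Qset n r S.ncard := by
    refine Set.ncard_le_ncard (fun j hj => ?_) (Set.toFinite S)
    by_contra hjS
    exact hj (funext fun i => if_neg hjS)
  refine (distQ_le_frobNorm_sub Z hZ').trans
    ((frobNorm_le_sum_colNorm _).trans_eq (Finset.sum_congr rfl fun j _ => ?_))
  by_cases hj : j ∈ S <;> simp [colNorm, Z', hj]

theorem Admissible.div_le {ν : ℝ} {ψ : ℝ → ℝ} (hψ : Admissible ν ψ) {x : ℝ} (hx : 0 ≤ x)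
    (hxν : x < ν) : x / ν ≤ ψ x := by
  rcases hx.eq_or_lt with rfl | hx
  · simp [hψ.1]
  · exact (hψ.2.1 x hx hxν).1

/-- Key inequality of Case 2 in the proof of Theorem 3.2, matrix case: with
`M' = #{j : ‖Z(:,j)‖₂ ≥ ν}`, one has `‖Z‖_{F,1}^ψ ≥ (1/ν)·dist(Z, Q^{M'}) + M'`. -/
theorem psiNorm_ge_dist_add_card {n r : ℕ} (Z : Matrix (Fin n) (Fin r) ℝ)
    (ν : ℝ) (hν : 0 < ν) (ψ : ℝ → ℝ) (hψ : Admissible ν ψ) :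
    (1 / ν) * distQ Z ({j : Fin r | ν ≤ colNorm Z j}.ncard) +
        (({j : Fin r | ν ≤ colNorm Z j}.ncard : ℝ)) ≤ psiNorm ψ Z := by
  classical
  set S : Set (Fin r) := {j | ν ≤ colNorm Z j}
  have hcard : (S.ncard : ℝ) = ∑ j, if j ∈ S then (1 : ℝ) else 0 := by
    rw [Set.ncard_eq_toFinset_card', Finset.sum_boole]
    congr 2
    ext j
    simp
  calc (1 / ν) * distQ Z S.ncard + S.ncard
      ≤ (1 / ν) * (∑ j, if j ∈ S then 0 else colNorm Z j) + ∑ j, if j ∈ S then (1 : ℝ) else 0 := by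
        rw [← hcard]
        gcongr
        exact distQ_ncard_le_sum_colNorm Z S
    _ = ∑ j, if j ∈ S then 1 else colNorm Z j / ν := by
        rw [Finset.mul_sum, ← Finset.sum_add_distrib]
        refine Finset.sum_congr rfl fun j _ => ?_
        split_ifs <;> ring
    _ ≤ psiNorm ψ Z := by
        refine Finset.sum_le_sum fun j _ => ?_
        split_ifs with hj
        · exact (hψ.2.2 _ hj).ge
        · exact hψ.div_le (colNorm_nonneg Z j) (not_le.mp hj)
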